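/- Let A be an integer matrix with entries in {−1,0,1,2} and b a vector with entries in {0,1}. Replace each variable x by a pair (x, x'), add the constraint x − x' = 0, and in every original constraint replace each coefficient 2 on x by coefficient 1 on both x and x'. The resulting system {A'x = b', x ≥ 0} has entries in {−1,0,1}, is feasible over nonnegative integers if and only if the original system is, and satisfies td_D(A') ≤ td_D(A) + 1. -/

import Mathlib

def TreedepthLE {V : Type*} (G : SimpleGraph V) (h : ℕ) : Prop :=
  ∃ le : V → V → Prop,
    (∀ v, le v v) ∧
    (∀ a b c, le a b → le b c → le a c) ∧
    (∀ a b, le a b → le b a → a = b) ∧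
    (∀ a b c, le a c → le b c → le a b ∨ le b a) ∧
    (∀ a b, G.Adj a b → le a b ∨ le b a) ∧
    (∀ s : Finset V, (∀ a ∈ s, ∀ b ∈ s, le a b ∨ le b a) → s.card ≤ h)

noncomputable def treedepth {V : Type*} (G : SimpleGraph V) : ℕ :=
  sInf {h | TreedepthLE G h}

def dualGraph {k n : Type*} (A : Matrix k n ℤ) : SimpleGraph k :=
  SimpleGraph.fromRel fun i j => ∃ col, A i col ≠ 0 ∧ A j col ≠ 0

/-- Attaching to `G` an independent set of new vertices, the neighbourhood of each being contained
in a clique of `G`, increases treedepth by at most one. -/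
theorem TreedepthLE.sum_of_isClique {V W : Type*} {G : SimpleGraph V} {H : SimpleGraph (V ⊕ W)}
    {h : ℕ} (hG : TreedepthLE G h) (N : W → Set V) (hN : ∀ w, G.IsClique (N w))
    (hll : ∀ a b, H.Adj (Sum.inl a) (Sum.inl b) → G.Adj a b)
    (hlr : ∀ a w, H.Adj (Sum.inl a) (Sum.inr w) → a ∈ N w)
    (hrr : ∀ w w', ¬ H.Adj (Sum.inr w) (Sum.inr w')) :
    TreedepthLE H (h + 1) := by
  obtain ⟨le, hrefl, htrans, hanti, hforest, hadj, hcard⟩ := hG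
  have hchain : ∀ w, ∀ a ∈ N w, ∀ b ∈ N w, le a b ∨ le b a := fun w a ha b hb => by
    by_cases hab : a = b
    · exact Or.inl (hab ▸ hrefl a)
    · exact hadj a b (hN w ha hb hab)
  refine ⟨fun x y => match x, y with
    | Sum.inl a, Sum.inl b => le a b
    | Sum.inl a, Sum.inr w => ∃ c ∈ N w, le a c
    | Sum.inr _, Sum.inl _ => False
    | Sum.inr w, Sum.inr w' => w = w', ?_, ?_, ?_, ?_, ?_, ?_⟩
  · rintro (a | w)
    · exact hrefl a
    · rfl
  · rintro (a | a) (b | b) (c | c) hab hbc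
    · exact htrans a b c hab hbc
    · obtain ⟨d, hd, hbd⟩ := hbc
      exact ⟨d, hd, htrans a b d hab hbd⟩
    · exact hbc.elim
    · obtain rfl : b = c := hbc
      exact hab
    · exact hab.elim
    · exact hab.elim
    · exact hbc.elim
    · exact Eq.trans hab hbc
  · rintro (a | a) (b | b) hab hba
    · exact congrArg _ (hanti a b hab hba)
    · exact hba.elim
    · exact hab.elim
    · exact congrArg _ hab
  · rintro (a | a) (b | b) (c | c) hac hbc
    · exact hforest a b c hac hbc
    · obtain ⟨d, hd, had⟩ := hac
      obtain ⟨e, he, hbe⟩ := hbc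
      rcases hchain c d hd e he with hde | hed
      · exact hforest a b e (htrans a d e had hde) hbe
      · exact hforest a b d had (htrans b e d hbe hed)
    · exact hbc.elim
    · obtain rfl : b = c := hbc
      exact Or.inl hac
    · exact hac.elim
    · obtain rfl : a = c := hac
      exact Or.inr hbc
    · exact hac.elim
    · exact Or.inl (Eq.trans hac (Eq.symm hbc))
  · rintro (a | a) (b | b) hab
    · exact hadj a b (hll a b hab)
    · exact Or.inl ⟨a, hlr a b hab, hrefl a⟩
    · exact Or.inr ⟨b, hlr b a hab.symm, hrefl b⟩
    · exact (hrr a b hab).elim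
  · intro s hs
    rw [← Finset.card_toLeft_add_card_toRight]
    refine add_le_add (hcard _ fun a ha b hb => ?_) (Finset.card_le_one.2 fun a ha b hb => ?_)
    · exact hs _ (Finset.mem_toLeft.1 ha) _ (Finset.mem_toLeft.1 hb)
    · exact (hs _ (Finset.mem_toRight.1 ha) _ (Finset.mem_toRight.1 hb)).elim id Eq.symm

/-- Any linear order on the vertices witnesses that treedepth is at most the number of vertices. -/
theorem treedepthLE_card {V : Type*} [Fintype V] [LinearOrder V] (G : SimpleGraph V) :
    TreedepthLE G (Fintype.card V) :=
  ⟨(· ≤ ·), le_refl, fun _ _ _ => le_trans, fun _ _ => le_antisymm,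
    fun a b _ _ _ => le_total a b, fun a b _ => le_total a b, fun s _ => s.card_le_univ⟩

theorem treedepthLE_treedepth {V : Type*} [Fintype V] [LinearOrder V] (G : SimpleGraph V) :
    TreedepthLE G (treedepth G) :=
  Nat.sInf_mem (s := {h | TreedepthLE G h}) ⟨_, treedepthLE_card G⟩

theorem TreedepthLE.treedepth_le {V : Type*} {G : SimpleGraph V} {h : ℕ} (hG : TreedepthLE G h) :
    treedepth G ≤ h :=
  Nat.sInf_le hG

theorem dualGraph_adj {k n : Type*} {A : Matrix k n ℤ} {i j : k} :
    (dualGraph A).Adj i j ↔ i ≠ j ∧ ∃ col, A i col ≠ 0 ∧ A j col ≠ 0 := by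
  simp only [dualGraph, SimpleGraph.fromRel_adj]
  refine and_congr_right fun _ => or_iff_left_of_imp ?_
  rintro ⟨col, hj, hi⟩
  exact ⟨col, hi, hj⟩

/-- duplicating variables to remove coefficient 2. Given A with
entries in {−1,0,1,2} and b with entries in {0,1}, each variable x_j gets a
duplicate x'_j with constraint x_j − x'_j = 0, and each coefficient 2 on x_j is
replaced by coefficient 1 on both x_j and x'_j. The resulting matrix A' has
entries in {−1,0,1}, the new system is feasible over ℕ iff the original one is,
and td_D(A') ≤ td_D(A) + 1. -/
theorem coefficient_two_removal (m n : ℕ)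
    (A : Matrix (Fin m) (Fin n) ℤ) (b : Fin m → ℤ)
    (hA : ∀ i j, A i j ∈ ({-1, 0, 1, 2} : Set ℤ))
    (hb : ∀ i, b i ∈ ({0, 1} : Set ℤ))
    (A' : Matrix (Fin m ⊕ Fin n) (Fin n ⊕ Fin n) ℤ)
    (b' : (Fin m ⊕ Fin n) → ℤ)
    (hA' : ∀ x y, A' x y =
      match x, y with
      | Sum.inl i, Sum.inl j => if A i j = 2 then 1 else A i j
      | Sum.inl i, Sum.inr j => if A i j = 2 then 1 else 0
      | Sum.inr j, Sum.inl j' => if j = j' then 1 else 0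
      | Sum.inr j, Sum.inr j' => if j = j' then -1 else 0)
    (hb' : ∀ x, b' x = match x with
      | Sum.inl i => b i
      | Sum.inr _ => 0) :
    (∀ x y, A' x y ∈ ({-1, 0, 1} : Set ℤ)) ∧
    ((∃ x : Fin n → ℕ, A.mulVec (fun j => (x j : ℤ)) = b) ↔
      (∃ x' : (Fin n ⊕ Fin n) → ℕ, A'.mulVec (fun j => (x' j : ℤ)) = b')) ∧
    treedepth (dualGraph A') ≤ treedepth (dualGraph A) + 1 := by
  have hll : ∀ i j, A' (Sum.inl i) (Sum.inl j) = if A i j = 2 then 1 else A i j :=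
    fun i j => hA' _ _
  have hlr : ∀ i j, A' (Sum.inl i) (Sum.inr j) = if A i j = 2 then 1 else 0 :=
    fun i j => hA' _ _
  have hrl : ∀ j j', A' (Sum.inr j) (Sum.inl j') = if j = j' then 1 else 0 :=
    fun j j' => hA' _ _
  have hrr : ∀ j j', A' (Sum.inr j) (Sum.inr j') = if j = j' then -1 else 0 :=
    fun j j' => hA' _ _
  have hbl : ∀ i, b' (Sum.inl i) = b i := fun i => hb' _
  have hbr : ∀ j, b' (Sum.inr j) = 0 := fun j => hb' _
  have hsplit : ∀ i j, A' (Sum.inl i) (Sum.inl j) + A' (Sum.inl i) (Sum.inr j) = A i j := by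
    intro i j
    rw [hll, hlr]
    split_ifs <;> omega
  have hrow : ∀ (x : Fin n → ℕ) i,
      A'.mulVec (fun j => ((Sum.elim x x j : ℕ) : ℤ)) (Sum.inl i) =
        A.mulVec (fun j => (x j : ℤ)) i := by
    intro x i
    simp only [Matrix.mulVec, dotProduct, Fintype.sum_sum_type, Sum.elim_inl, Sum.elim_inr,
      ← Finset.sum_add_distrib, ← add_mul, hsplit]
  have hdup : ∀ (x' : Fin n ⊕ Fin n → ℕ) j,
      A'.mulVec (fun j => (x' j : ℤ)) (Sum.inr j) = x' (Sum.inl j) - x' (Sum.inr j) := by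
    intro x' j
    simp [Matrix.mulVec, dotProduct, hrl, hrr, sub_eq_add_neg]
  refine ⟨?_, ⟨?_, ?_⟩, ?_⟩
  · rintro (i | i) (j | j)
    · have := hA i j
      simp only [Set.mem_insert_iff, Set.mem_singleton_iff] at this ⊢
      rw [hll]
      split_ifs <;> omega
    · rw [hlr]
      split_ifs <;> simp
    · rw [hrl]
      split_ifs <;> simp
    · rw [hrr]
      split_ifs <;> simp
  · rintro ⟨x, hx⟩
    refine ⟨Sum.elim x x, funext ?_⟩
    rintro (i | j)
    · rw [hrow, hx, hbl]
    · rw [hdup, hbr]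
      simp
  · rintro ⟨x', hx'⟩
    have heq : ∀ j, x' (Sum.inl j) = x' (Sum.inr j) := fun j => by
      have := hdup x' j
      rw [hx', hbr] at this
      omega
    have hx'_elim : Sum.elim (fun j => x' (Sum.inl j)) (fun j => x' (Sum.inl j)) = x' := by
      ext (j | j)
      · rfl
      · exact heq j
    refine ⟨fun j => x' (Sum.inl j), funext fun i => ?_⟩
    rw [← hrow, hx'_elim, hx', hbl]
  · have hl_ne : ∀ i j, A' (Sum.inl i) (Sum.inl j) ≠ 0 → A i j ≠ 0 := by
      intro i j h
      contrapose! h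
      simp [hll, h]
    have hr_ne : ∀ i j, A' (Sum.inl i) (Sum.inr j) ≠ 0 → A i j ≠ 0 := by
      intro i j h
      contrapose! h
      simp [hlr, h]
    refine TreedepthLE.treedepth_le ((treedepthLE_treedepth (dualGraph A)).sum_of_isClique
      (fun j => {i | A i j ≠ 0}) ?_ ?_ ?_ ?_)
    · exact fun j a ha b hb hab => dualGraph_adj.2 ⟨hab, j, ha, hb⟩
    · intro i i' h
      obtain ⟨hne, j | j, hi, hi'⟩ := dualGraph_adj.1 h
      · exact dualGraph_adj.2 ⟨fun e => hne (congrArg _ e), j, hl_ne _ _ hi, hl_ne _ _ hi'⟩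
      · exact dualGraph_adj.2 ⟨fun e => hne (congrArg _ e), j, hr_ne _ _ hi, hr_ne _ _ hi'⟩
    · intro i w h
      obtain ⟨-, j | j, hi, hw⟩ := dualGraph_adj.1 h
      · obtain rfl : w = j := by simpa [hrl] using hw
        exact hl_ne _ _ hi
      · obtain rfl : w = j := by simpa [hrr] using hw
        exact hr_ne _ _ hi
    · intro w w' h
      obtain ⟨hne, j | j, hw, hw'⟩ := dualGraph_adj.1 h
      · simp only [hrl, ne_eq, ite_eq_right_iff, one_ne_zero, imp_false, not_not] at hw hw'
        exact hne (congrArg _ (hw.trans hw'.symm))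
      · simp only [hrr, ne_eq, ite_eq_right_iff, neg_eq_zero, one_ne_zero, imp_false,
          not_not] at hw hw'
        exact hne (congrArg _ (hw.trans hw'.symm))
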